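/- arXiv:2205.09711 — 2 statements merged into one kernel-verified Lean document; each statement's English description precedes it below -/
import Mathlib

section
/- Let d ≥ 2 and let X : Matrix (Fin d × Fin d) (Fin d × Fin d) ℂ be any matrix. Then ∫ U, (U ⊗ U)ᴴ · X · (U ⊗ U) dμ_d = ((trace(X) − trace(X·F)/d) / (d² − 1)) • 1 + ((trace(X·F) − trace(X)/d) / (d² − 1)) • F, where U ⊗ U is the Kronecker product, 1 is the identity on Fin d × Fin d, and F = F_{Fin d} is the swap operator. -/
open MeasureTheory Matrix
open scoped Kronecker

noncomputable section

attribute [local instance] Matrix.normedAddCommGroup Matrix.normedSpace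

local instance {d : ℕ} : MeasurableSpace (Matrix.unitaryGroup (Fin d) ℂ) := borel _

/-- The swap operator `F` on the doubled space `A × A`:
`F (i,j) (k,l) = 1` iff `i = l` and `j = k`. -/
def swapOp (A : Type*) [DecidableEq A] : Matrix (A × A) (A × A) ℂ :=
  Matrix.of fun p q => if p.1 = q.2 ∧ p.2 = q.1 then 1 else 0

/-- entries of a product with a Kronecker square, on both sides. -/
lemma comm_entry {d : ℕ} {T : Matrix (Fin d × Fin d) (Fin d × Fin d) ℂ}
    {V : Matrix (Fin d) (Fin d) ℂ} (h : (V ⊗ₖ V) * T = T * (V ⊗ₖ V)) (p q : Fin d × Fin d) :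
    ∑ r, V p.1 r.1 * V p.2 r.2 * T r q = ∑ r, T p r * (V r.1 q.1 * V r.2 q.2) := by
  have := congrFun (congrFun h p) q
  simpa [Matrix.mul_apply, Matrix.kroneckerMap_apply] using this

/-- The phase matrix with `I` at position `m` and `1` elsewhere. -/
def phaseVec {d : ℕ} (m : Fin d) : Fin d → ℂ := fun i => if i = m then Complex.I else 1

lemma phase_mem {d : ℕ} (m : Fin d) :
    Matrix.diagonal (phaseVec m) ∈ Matrix.unitaryGroup (Fin d) ℂ := by
  rw [Matrix.mem_unitaryGroup_iff, Matrix.star_eq_conjTranspose, Matrix.diagonal_conjTranspose,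
    Matrix.diagonal_mul_diagonal, ← Matrix.diagonal_one]
  congr 1
  funext i
  by_cases h : i = m <;> simp [phaseVec, h]

/-- The unitary `(1 - P) + I P` with `P` the projection on the constant vector. -/
def refl' (d : ℕ) : Matrix (Fin d) (Fin d) ℂ :=
  1 + Matrix.of fun _ _ => (Complex.I - 1) / (d : ℂ)

lemma refl'_apply (d : ℕ) (i j : Fin d) :
    refl' d i j = (if i = j then 1 else 0) + (Complex.I - 1) / (d : ℂ) := by
  simp [refl', Matrix.one_apply]

lemma refl'_mem (d : ℕ) (hd : 2 ≤ d) : refl' d ∈ Matrix.unitaryGroup (Fin d) ℂ := by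
  have hd0 : (d : ℂ) ≠ 0 := by exact_mod_cast (by omega : d ≠ 0)
  rw [Matrix.mem_unitaryGroup_iff, Matrix.star_eq_conjTranspose]
  ext i j
  have hs : ∀ i j, star (refl' d i j) = (if i = j then 1 else 0) + (-Complex.I - 1) / (d : ℂ) := by
    intro i j
    rw [refl'_apply]
    by_cases h : i = j <;> simp [h]
  simp only [Matrix.mul_apply, Matrix.conjTranspose_apply, hs]
  simp only [refl'_apply]
  simp only [add_mul, mul_add, Finset.sum_add_distrib, ite_mul, mul_ite, one_mul, mul_one,
    zero_mul, mul_zero, Finset.sum_ite_eq, Finset.sum_ite_eq', Finset.mem_univ, if_true,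
    Finset.sum_const, Finset.card_univ, Fintype.card_fin, nsmul_eq_mul, Matrix.one_apply]
  have h2 : (Complex.I - 1) / (d : ℂ) + ((-Complex.I - 1) / (d : ℂ) +
      (d : ℂ) * ((Complex.I - 1) / (d : ℂ) * ((-Complex.I - 1) / (d : ℂ)))) = 0 := by
    field_simp
    ring_nf
    simp
  by_cases h : i = j
  · simp only [h, if_true]
    linear_combination h2
  · simp only [h, Ne.symm h, if_false]
    linear_combination h2

lemma phase_support {d : ℕ} {T : Matrix (Fin d × Fin d) (Fin d × Fin d) ℂ}
    (h : ∀ V ∈ Matrix.unitaryGroup (Fin d) ℂ, (V ⊗ₖ V) * T = T * (V ⊗ₖ V))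
    (i j k l : Fin d) (hT : T (i, j) (k, l) ≠ 0) :
    (i = k ∧ j = l) ∨ (i = l ∧ j = k) := by
  have key : ∀ m, phaseVec m i * phaseVec m j = phaseVec m k * phaseVec m l := by
    intro m
    have := congrFun (congrFun (h _ (phase_mem m)) (i, j)) (k, l)
    rw [Matrix.diagonal_kronecker_diagonal, Matrix.diagonal_mul, Matrix.mul_diagonal,
      mul_comm] at this
    exact mul_left_cancel₀ hT this
  have h1 : Complex.I ≠ 1 := by
    intro h; have := congrArg Complex.re h; simp at this
  have h2 : (-1 : ℂ) ≠ 1 := by norm_num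
  have h3 : (-1 : ℂ) ≠ Complex.I := by
    intro h; have := congrArg Complex.re h; simp at this
  have ki := key i
  have kj := key j
  simp only [phaseVec] at ki kj
  by_cases a : i = k
  · subst a
    left
    refine ⟨rfl, ?_⟩
    by_contra b
    by_cases c : j = i
    · subst c
      simp [Ne.symm b, h1, h3] at kj
      
    · simp [c, Ne.symm b, Ne.symm c, h1] at kj
  · by_cases b : i = l
    · subst b
      right
      refine ⟨rfl, ?_⟩
      by_contra c
      by_cases e : j = i
      · subst e
        simp [Ne.symm a, h1, h3] at kj
      · simp [e, Ne.symm c, Ne.symm e, h1] at kj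
    · exfalso
      by_cases c : j = i
      · subst c
        simp [Ne.symm a, Ne.symm b, h2] at ki
      · simp [Ne.symm a, Ne.symm b, c, h1] at ki

/-- The commutant of all `V ⊗ V` is spanned by the identity and the swap. -/
lemma commutant {d : ℕ} (hd : 2 ≤ d) {T : Matrix (Fin d × Fin d) (Fin d × Fin d) ℂ}
    (h : ∀ V ∈ Matrix.unitaryGroup (Fin d) ℂ, (V ⊗ₖ V) * T = T * (V ⊗ₖ V)) :
    ∃ a b : ℂ, T = a • (1 : Matrix (Fin d × Fin d) (Fin d × Fin d) ℂ) + b • swapOp (Fin d) := by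
  have hd0 : (d : ℂ) ≠ 0 := by exact_mod_cast (by omega : d ≠ 0)
  have supp := phase_support h
  have hR := comm_entry (h _ (refl'_mem d hd))
  obtain ⟨y, hy⟩ : ∃ y : ℂ, y = (Complex.I - 1) / (d : ℂ) := ⟨_, rfl⟩
  have hI : Complex.I - 1 ≠ 0 := by
    intro h; have := congrArg Complex.im h; simp at this
  have hy0 : y ≠ 0 := by rw [hy]; exact div_ne_zero hI hd0
  have hy1 : 1 + y ≠ 0 := by
    intro h
    rw [hy] at h
    field_simp at h
    have := congrArg Complex.im h
    simp at this
  simp only [refl'_apply, ← hy] at hR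
  have zero : ∀ i j k l, ¬ ((i = k ∧ j = l) ∨ (i = l ∧ j = k)) → T (i, j) (k, l) = 0 := by
    intro i j k l hn
    by_contra hc
    exact hn (supp i j k l hc)
  -- sum over second index, first index off-diagonal
  have rowsum : ∀ (i j : Fin d), i ≠ j → ∀ f : Fin d × Fin d → ℂ,
      ∑ r, T (i, j) r * f r = T (i, j) (i, j) * f (i, j) + T (i, j) (j, i) * f (j, i) := by
    intro i j hij f
    apply Fintype.sum_eq_add
    · simp [hij]
    · rintro ⟨k, l⟩ hx
      rw [zero, zero_mul]
      simp only [ne_eq, Prod.mk.injEq] at hx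
      grind
  have colsum : ∀ (i j : Fin d), i ≠ j → ∀ f : Fin d × Fin d → ℂ,
      ∑ r, f r * T r (i, j) = f (i, j) * T (i, j) (i, j) + f (j, i) * T (j, i) (i, j) := by
    intro i j hij f
    apply Fintype.sum_eq_add
    · simp [hij]
    · rintro ⟨k, l⟩ hx
      rw [zero, mul_zero]
      simp only [ne_eq, Prod.mk.injEq] at hx
      grind
  have colsum' : ∀ (i : Fin d), ∀ f : Fin d × Fin d → ℂ,
      ∑ r, f r * T r (i, i) = f (i, i) * T (i, i) (i, i) := by
    intro i f
    apply Fintype.sum_eq_single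
    rintro ⟨k, l⟩ hx
    rw [zero, mul_zero]
    simp only [ne_eq, Prod.mk.injEq] at hx
    grind
  -- diagonal relation
  have diag : ∀ i j k, i ≠ j → T (k, k) (k, k) = T (i, j) (i, j) + T (i, j) (j, i) := by
    intro i j k hij
    have e := hR (i, j) (k, k)
    rw [colsum', rowsum i j hij] at e
    have hne : ∀ a b : Fin d, ((if a = b then 1 else 0) + y : ℂ) ≠ 0 := by
      intro a b
      by_cases hab : a = b <;> simp [hab, hy0, hy1]
    have := mul_ne_zero (hne i k) (hne j k)
    apply mul_left_cancel₀ this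
    linear_combination e
  have off : ∀ i j k l, i ≠ j → k ≠ l →
      ((if i = k then 1 else 0) + y) * ((if j = l then 1 else 0) + y) * T (k, l) (k, l)
        + ((if i = l then 1 else 0) + y) * ((if j = k then 1 else 0) + y) * T (l, k) (k, l)
      = T (i, j) (i, j) * (((if i = k then 1 else 0) + y) * ((if j = l then 1 else 0) + y))
        + T (i, j) (j, i) * (((if j = k then 1 else 0) + y) * ((if i = l then 1 else 0) + y)) := by
    intro i j k l hij hkl
    have e := hR (i, j) (k, l)
    rw [colsum k l hkl, rowsum i j hij] at e
    exact e
  have gsymm : ∀ i j, i ≠ j → T (j, i) (i, j) = T (i, j) (j, i) := by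
    intro i j hij
    have e := off i j i j hij hij
    simp only [hij, Ne.symm hij, if_true, if_false, zero_add] at e
    apply mul_left_cancel₀ (mul_ne_zero hy0 hy0)
    linear_combination e
  have bsymm : ∀ i j, i ≠ j → T (j, i) (j, i) = T (i, j) (i, j) := by
    intro i j hij
    linear_combination diag i j i hij - diag j i i hij.symm - gsymm i j hij
  have brow : ∀ i j l, i ≠ j → i ≠ l → T (i, j) (i, j) = T (i, l) (i, l) := by
    intro i j l hij hil
    by_cases hjl : j = l
    · rw [hjl]
    have e := off i j i l hij hil
    simp only [hij.symm, hil, hjl, if_true, if_false, zero_add] at e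
    apply mul_left_cancel₀ hy0
    rw [gsymm i l hil] at e
    linear_combination (-1 : ℂ) * e + y ^ 2 * diag i j i hij - y ^ 2 * diag i l i hil
  have ball : ∀ i j k l, i ≠ j → k ≠ l → T (i, j) (i, j) = T (k, l) (k, l) := by
    intro i j k l hij hkl
    by_cases hik : i = k
    · subst hik; exact brow i j l hij hkl
    · rw [brow i j k hij hik, bsymm k i (Ne.symm hik), brow k i l (Ne.symm hik) hkl]
  let z : Fin d := ⟨0, by omega⟩
  let o : Fin d := ⟨1, by omega⟩
  have hzo : z ≠ o := by simp [z, o]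
  refine ⟨T (z, o) (z, o), T (z, o) (o, z), ?_⟩
  ext ⟨i, j⟩ ⟨k, l⟩
  simp only [Matrix.add_apply, Matrix.smul_apply, Matrix.one_apply, swapOp, Matrix.of_apply,
    smul_eq_mul, Prod.mk.injEq]
  by_cases hij : i = j
  · subst hij
    by_cases hk : i = k ∧ i = l
    · obtain ⟨rfl, rfl⟩ := hk
      simpa using diag z o i hzo
    · rw [zero _ _ _ _ (by grind), if_neg hk, if_neg (by grind)]; simp
  · by_cases hk : i = k ∧ j = l
    · obtain ⟨rfl, rfl⟩ := hk
      rw [if_pos ⟨rfl, rfl⟩, if_neg (by grind), ball i j z o hij hzo]; simp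
    · by_cases hk2 : i = l ∧ j = k
      · obtain ⟨rfl, rfl⟩ := hk2
        rw [if_neg hk, if_pos ⟨rfl, rfl⟩]
        linear_combination diag z o z hzo - diag i j z hij - ball i j z o hij hzo
      · rw [zero _ _ _ _ (by grind), if_neg hk, if_neg hk2]; simp

local instance {d : ℕ} : BorelSpace (Matrix.unitaryGroup (Fin d) ℂ) := ⟨rfl⟩

lemma compact_U (d : ℕ) : CompactSpace (Matrix.unitaryGroup (Fin d) ℂ) := by
  rw [← isCompact_univ_iff, Subtype.isCompact_iff, Set.image_univ, Subtype.range_coe]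
  have hc : IsClosed ((Matrix.unitaryGroup (Fin d) ℂ : Set (Matrix (Fin d) (Fin d) ℂ))) :=
    isClosed_unitary
  have : ProperSpace (Matrix (Fin d) (Fin d) ℂ) := FiniteDimensional.proper ℂ _
  refine Metric.isCompact_of_isClosed_isBounded hc ?_
  refine (Metric.isBounded_closedBall (x := (0 : Matrix (Fin d) (Fin d) ℂ)) (r := 1)).subset ?_
  intro U hU
  rw [mem_closedBall_zero_iff, Matrix.norm_le_iff zero_le_one]
  exact fun i j => entry_norm_bound_of_unitary hU i j

section
variable {d : ℕ} (μ : Measure (Matrix.unitaryGroup (Fin d) ℂ)) [μ.IsHaarMeasure]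

/-- The Kronecker square. -/
def kk (U : Matrix.unitaryGroup (Fin d) ℂ) : Matrix (Fin d × Fin d) (Fin d × Fin d) ℂ :=
  (U : Matrix (Fin d) (Fin d) ℂ) ⊗ₖ (U : Matrix (Fin d) (Fin d) ℂ)

lemma kk_cont : Continuous (kk (d := d)) := by
  refine continuous_matrix fun i j => ?_
  exact (continuous_subtype_val.matrix_elem _ _).mul (continuous_subtype_val.matrix_elem _ _)

lemma kk_mul (U V : Matrix.unitaryGroup (Fin d) ℂ) : kk (U * V) = kk U * kk V := by
  simp [kk, Matrix.mul_kronecker_mul]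

lemma kk_star_mul (U : Matrix.unitaryGroup (Fin d) ℂ) : (kk U)ᴴ * kk U = 1 := by
  have : (U : Matrix (Fin d) (Fin d) ℂ)ᴴ * (U : Matrix (Fin d) (Fin d) ℂ) = 1 :=
    Unitary.coe_star_mul_self U
  rw [kk, Matrix.conjTranspose_kronecker, ← Matrix.mul_kronecker_mul, this,
    Matrix.one_kronecker_one]

lemma kk_swap (U : Matrix.unitaryGroup (Fin d) ℂ) :
    kk U * swapOp (Fin d) = swapOp (Fin d) * kk U := by
  ext ⟨i, j⟩ ⟨k, l⟩
  rw [Matrix.mul_apply, Matrix.mul_apply, Fintype.sum_eq_single (l, k), Fintype.sum_eq_single (j, i)]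
  · simp [kk, swapOp, Matrix.kroneckerMap_apply, mul_comm]
  · rintro ⟨a, b⟩ hx
    simp only [ne_eq, Prod.mk.injEq] at hx
    simp only [swapOp, Matrix.of_apply]
    rw [if_neg (by grind), zero_mul]
  · rintro ⟨a, b⟩ hx
    simp only [ne_eq, Prod.mk.injEq] at hx
    simp only [swapOp, Matrix.of_apply]
    rw [if_neg (by grind), mul_zero]

lemma cont_integrable {E : Type*} [NormedAddCommGroup E]
    {f : Matrix.unitaryGroup (Fin d) ℂ → E} (hf : Continuous f) : Integrable f μ := by
  have := compact_U d
  exact hf.integrable_of_hasCompactSupport (HasCompactSupport.of_compactSpace f)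

lemma lin_integral {E F : Type*} [NormedAddCommGroup E] [NormedSpace ℂ E] [FiniteDimensional ℂ E]
    [NormedAddCommGroup F] [NormedSpace ℂ F] [FiniteDimensional ℂ F]
    {f : Matrix.unitaryGroup (Fin d) ℂ → E} (hf : Continuous f) (L : E →ₗ[ℂ] F) :
    L (∫ U, f U ∂μ) = ∫ U, L (f U) ∂μ := by
  have : CompleteSpace E := FiniteDimensional.complete ℂ E
  have : CompleteSpace F := FiniteDimensional.complete ℂ F
  exact (ContinuousLinearMap.integral_comp_comm (LinearMap.toContinuousLinearMap L)
    (cont_integrable μ hf)).symm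

lemma tw_cont (Y : Matrix (Fin d × Fin d) (Fin d × Fin d) ℂ) :
    Continuous fun U => kk U * Y * (kk U)ᴴ :=
  (kk_cont.matrix_mul continuous_const).matrix_mul kk_cont.matrix_conjTranspose

lemma tw_cont' (Y : Matrix (Fin d × Fin d) (Fin d × Fin d) ℂ) :
    Continuous fun U => (kk U)ᴴ * Y * kk U :=
  (kk_cont.matrix_conjTranspose.matrix_mul continuous_const).matrix_mul kk_cont

lemma trace_swap_one : (swapOp (Fin d)).trace = d := by
  simp only [Matrix.trace, Matrix.diag, swapOp, Matrix.of_apply, Fintype.sum_prod_type]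
  have : ∀ x y : Fin d, (x = y ∧ y = x) ↔ x = y := by grind
  simp [this]

lemma swap_mul_swap : swapOp (Fin d) * swapOp (Fin d) = 1 := by
  ext ⟨i, j⟩ ⟨k, l⟩
  rw [Matrix.mul_apply, Fintype.sum_eq_single (j, i)]
  · simp only [swapOp, Matrix.of_apply, Matrix.one_apply, Prod.mk.injEq]
    grind
  · rintro ⟨a, b⟩ hx
    simp only [ne_eq, Prod.mk.injEq] at hx
    simp only [swapOp, Matrix.of_apply]
    rw [if_neg (by grind), zero_mul]

lemma tw_comm (Y : Matrix (Fin d × Fin d) (Fin d × Fin d) ℂ) :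
    ∀ V ∈ Matrix.unitaryGroup (Fin d) ℂ,
      (V ⊗ₖ V) * (∫ U, kk U * Y * (kk U)ᴴ ∂μ) = (∫ U, kk U * Y * (kk U)ᴴ ∂μ) * (V ⊗ₖ V) := by
  intro V hV
  change kk ⟨V, hV⟩ * _ = _ * kk ⟨V, hV⟩
  generalize (⟨V, hV⟩ : Matrix.unitaryGroup (Fin d) ℂ) = W
  have e1 : ∫ U, kk U * Y * (kk U)ᴴ ∂μ
      = kk W * (∫ U, kk U * Y * (kk U)ᴴ ∂μ) * (kk W)ᴴ := by
    have := lin_integral μ (tw_cont Y)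
      ((LinearMap.mulRight ℂ (kk W)ᴴ).comp (LinearMap.mulLeft ℂ (kk W)))
    simp only [LinearMap.comp_apply, LinearMap.mulRight_apply, LinearMap.mulLeft_apply] at this
    rw [this, ← integral_mul_left_eq_self (fun U => kk U * Y * (kk U)ᴴ) W]
    congr 1
    funext U
    simp only [kk_mul, Matrix.conjTranspose_mul, Matrix.mul_assoc]
  conv_rhs => rw [e1, Matrix.mul_assoc, kk_star_mul, Matrix.mul_one]

lemma entry_eq (hd : 2 ≤ d) (X : Matrix (Fin d × Fin d) (Fin d × Fin d) ℂ)
    (p q : Fin d × Fin d) :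
    (∫ U, (kk U)ᴴ * X * kk U ∂μ) p q
      = (X * ∫ U, kk U * Matrix.single q p (1 : ℂ) * (kk U)ᴴ ∂μ).trace := by
  have h1 := lin_integral μ (tw_cont' X) (Matrix.entryLinearMap ℂ ℂ p q)
  have h2 := lin_integral μ (tw_cont (Matrix.single q p (1 : ℂ)))
    ((Matrix.traceLinearMap (Fin d × Fin d) ℂ ℂ).comp (LinearMap.mulLeft ℂ X))
  simp only [LinearMap.comp_apply, LinearMap.mulLeft_apply, Matrix.traceLinearMap_apply,
    Matrix.entryLinearMap_apply] at h1 h2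
  rw [h1, h2]
  congr 1
  funext U
  rw [← Matrix.mul_assoc, Matrix.trace_mul_comm, ← Matrix.mul_assoc, ← Matrix.mul_assoc,
    Matrix.trace_mul_single]
  simp

end

/-- **Double unitary twirling formula**:
`∫ U, (U ⊗ U)ᴴ X (U ⊗ U) dμ = [(tr X − tr(XF)/d)/(d²−1)] • 1 + [(tr(XF) − tr X/d)/(d²−1)] • F`. -/
theorem double_twirling (d : ℕ) (hd : 2 ≤ d)
    (X : Matrix (Fin d × Fin d) (Fin d × Fin d) ℂ)
    (μ : Measure (Matrix.unitaryGroup (Fin d) ℂ))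
    [μ.IsHaarMeasure] [IsProbabilityMeasure μ] :
    ∫ U : Matrix.unitaryGroup (Fin d) ℂ,
        ((U : Matrix (Fin d) (Fin d) ℂ) ⊗ₖ (U : Matrix (Fin d) (Fin d) ℂ))ᴴ * X *
          ((U : Matrix (Fin d) (Fin d) ℂ) ⊗ₖ (U : Matrix (Fin d) (Fin d) ℂ)) ∂μ
      = ((X.trace - (X * swapOp (Fin d)).trace / (d : ℂ)) / ((d : ℂ) ^ 2 - 1))
            • (1 : Matrix (Fin d × Fin d) (Fin d × Fin d) ℂ)
        + (((X * swapOp (Fin d)).trace - X.trace / (d : ℂ)) / ((d : ℂ) ^ 2 - 1))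
            • swapOp (Fin d) := by
  have hd0 : (d : ℂ) ≠ 0 := by exact_mod_cast (by omega : d ≠ 0)
  have hd1 : (d : ℂ) ^ 2 - 1 ≠ 0 := by
    have : (d : ℂ) ^ 2 ≠ 1 := by
      have h2 : d ^ 2 ≠ 1 := by nlinarith
      exact_mod_cast h2
    exact sub_ne_zero.mpr this
  change ∫ U, (kk U)ᴴ * X * kk U ∂μ = _
  ext p q
  have hX := fun X => entry_eq μ hd X p q
  obtain ⟨a, b, hab⟩ := commutant hd (tw_comm μ (Matrix.single q p (1 : ℂ)))
  rw [hab] at hX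
  simp only [Matrix.mul_add, Matrix.mul_smul, Matrix.mul_one, Matrix.trace_add,
    Matrix.trace_smul, smul_eq_mul] at hX
  have c1 := hX 1
  have cF := hX (swapOp (Fin d))
  have i1 : ∫ U, (kk U)ᴴ * 1 * kk U ∂μ = 1 := by
    simp [kk_star_mul]
  have iF : ∫ U, (kk U)ᴴ * swapOp (Fin d) * kk U ∂μ = swapOp (Fin d) := by
    simp [Matrix.mul_assoc, ← kk_swap]
    simp [← Matrix.mul_assoc, kk_star_mul]
  rw [i1] at c1
  rw [iF] at cF
  rw [hX X]
  simp only [Matrix.add_apply, Matrix.smul_apply, smul_eq_mul]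
  rw [c1, cF]
  simp only [Matrix.one_mul, trace_swap_one, swap_mul_swap, Matrix.trace_one, Fintype.card_prod,
    Fintype.card_fin, Nat.cast_mul]
  field_simp
  ring
end
end

section
/- Let A₁, A₂ be nonempty finite types with cardinalities d₁ = |A₁|, d₂ = |A₂| satisfying d₁·d₂ ≥ 2, and set A = A₁ × A₂ and d = d₁·d₂. Let X : Matrix (A × A) (A × A) ℂ be the operator F_{A₂A₂'} ⊗ I_{A₁A₁'}, with entries X(((a₁,a₂),(a₁',a₂')), ((b₁,b₂),(b₁',b₂'))) = 1 if a₁ = b₁, a₁' = b₁', a₂ = b₂', a₂' = b₂, and 0 otherwise. Then ∫ U, (U ⊗ U)ᴴ · X · (U ⊗ U) dμ = (1/d₂)·((1 − 1/d₁²)/(1 − 1/d²)) • 1 + (1/d₁)·((1 − 1/d₂²)/(1 − 1/d²)) • F_A, where μ is the Haar probability measure on Matrix.unitaryGroup A ℂ, U ⊗ U is the Kronecker product, and F_A is the swap operator on A. -/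
open MeasureTheory Matrix
open scoped Kronecker

noncomputable section

attribute [local instance] Matrix.normedAddCommGroup Matrix.normedSpace

local instance {A : Type*} [Fintype A] [DecidableEq A] :
    MeasurableSpace (Matrix.unitaryGroup A ℂ) := borel _

section helpers

variable {A : Type} [Fintype A] [DecidableEq A]

local instance twirlBorel : BorelSpace (Matrix.unitaryGroup A ℂ) := ⟨rfl⟩

lemma twirl_compact : CompactSpace (Matrix.unitaryGroup A ℂ) := by
  apply isCompact_iff_compactSpace.1
  have hK : IsCompact (Set.univ.pi fun _ : A => Set.univ.pi fun _ : A =>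
      Metric.closedBall (0 : ℂ) 1) :=
    isCompact_univ_pi fun _ => isCompact_univ_pi fun _ => isCompact_closedBall _ _
  refine IsCompact.of_isClosed_subset hK (isClosed_unitary (R := Matrix A A ℂ)) ?_
  intro U hU i _ j _
  simpa using entry_norm_bound_of_unitary hU i j

lemma twirl_right_inv (μ : Measure (Matrix.unitaryGroup A ℂ))
    [μ.IsHaarMeasure] [IsProbabilityMeasure μ] : μ.IsMulRightInvariant := by
  have := twirl_compact (A := A)
  constructor
  intro g
  have : IsProbabilityMeasure (μ.map (· * g)) :=
    Measure.isProbabilityMeasure_map (measurable_mul_const g).aemeasurable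
  exact Measure.isHaarMeasure_eq_of_isProbabilityMeasure _ _

/-- permutation matrix -/
def pm {B : Type} [DecidableEq B] (f : B ≃ B) : Matrix B B ℂ := f.toPEquiv.toMatrix

lemma pm_mul_apply {B : Type} [Fintype B] [DecidableEq B] (f : B ≃ B) (M : Matrix B B ℂ) (i j) :
    (pm f * M) i j = M (f i) j := by
  simp [pm, PEquiv.toMatrix_toPEquiv_mul]

lemma mul_pm_apply {B : Type} [Fintype B] [DecidableEq B] (f : B ≃ B) (M : Matrix B B ℂ) (i j) :
    (M * pm f) i j = M i (f.symm j) := by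
  simp [pm, PEquiv.mul_toMatrix_toPEquiv]

lemma pm_kron (f g : A ≃ A) : pm f ⊗ₖ pm g = pm (Equiv.prodCongr f g) := by
  ext ⟨a, b⟩ ⟨c, d⟩
  simp only [pm, kronecker_apply, PEquiv.toMatrix_apply]
  simp only [Equiv.toPEquiv_apply, Option.mem_some_iff, Equiv.prodCongr_apply, Prod.map_apply,
    Prod.mk.injEq]
  by_cases h1 : f a = c <;> by_cases h2 : g b = d <;> simp [h1, h2]

lemma pm_refl : pm (Equiv.refl A) = 1 := by
  simp [pm]

lemma pm_conj (f : A ≃ A) : star (pm f) = pm f.symm := by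
  ext a b
  simp [pm, PEquiv.toMatrix_apply, star_eq_conjTranspose, apply_ite, Equiv.eq_symm_apply,
    Equiv.symm_apply_eq, eq_comm]

lemma pm_mem (f : A ≃ A) : pm f ∈ Matrix.unitaryGroup A ℂ := by
  rw [Matrix.mem_unitaryGroup_iff, pm_conj]
  ext a b
  rw [pm_mul_apply]
  simp [pm, PEquiv.toMatrix_apply, Matrix.one_apply, eq_comm]

lemma twirl_schur [Nontrivial A] (T : Matrix (A × A) (A × A) ℂ)
    (hT : ∀ V ∈ Matrix.unitaryGroup A ℂ, (V ⊗ₖ V) * T = T * (V ⊗ₖ V)) :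
    ∃ β γ : ℂ, T = β • (1 : Matrix (A × A) (A × A) ℂ) + γ • swapOp A := by
  -- diagonal unitaries
  have hdiag : ∀ a b c d x : A, T (a, b) (c, d) ≠ 0 →
      (if a = x then Complex.I else 1) * (if b = x then Complex.I else 1) =
      (if c = x then Complex.I else 1) * (if d = x then Complex.I else 1) := by
    intro a b c d x h
    have hu : diagonal (fun i : A => if i = x then Complex.I else 1) ∈
        Matrix.unitaryGroup A ℂ := by
      rw [Matrix.mem_unitaryGroup_iff, star_eq_conjTranspose, diagonal_conjTranspose,
        diagonal_mul_diagonal, ← diagonal_one]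
      congr 1
      ext i
      by_cases hi : i = x <;> simp [hi]
    have h2 := congrFun (congrFun (hT _ hu) (a, b)) (c, d)
    rw [diagonal_kronecker_diagonal, diagonal_mul, mul_diagonal, mul_comm] at h2
    exact mul_left_cancel₀ h h2
  have hzero : ∀ a b c d : A, T (a, b) (c, d) ≠ 0 → (a = c ∧ b = d) ∨ (a = d ∧ b = c) := by
    intro a b c d h
    have h1 := hdiag a b c d a h
    have h2 := hdiag a b c d b h
    have h3 := hdiag a b c d c h
    have h4 := hdiag a b c d d h
    have i1 : Complex.I ≠ 1 := by simp [Complex.ext_iff]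
    have i2 : Complex.I * Complex.I ≠ 1 := by norm_num [Complex.ext_iff]
    have i3 : Complex.I * Complex.I ≠ Complex.I := by simp [Complex.ext_iff]
    generalize Complex.I = J at *
    clear hdiag hT h
    grind
  have hperm : ∀ (f : A ≃ A) (a b c d : A), T (f a, f b) (f c, f d) = T (a, b) (c, d) := by
    intro f a b c d
    have h := congrFun (congrFun (hT _ (pm_mem f)) (a, b)) (f c, f d)
    rw [pm_kron, pm_mul_apply, mul_pm_apply] at h
    simpa using h
  have hsq : ∀ a b : A, a ≠ b → T (a, a) (a, a) = T (a, b) (a, b) + T (a, b) (b, a) := by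
    intro a b hab
    set f := Equiv.swap a b with hf
    set p : ℂ := (1 + Complex.I) / 2 with hp
    set q : ℂ := (1 - Complex.I) / 2 with hq
    have hpp : pm f * pm f = 1 := by
      have := (Matrix.mem_unitaryGroup_iff).1 (pm_mem f)
      rwa [pm_conj, hf, Equiv.symm_swap] at this
    have hu : p • (1 : Matrix A A ℂ) + q • pm f ∈ Matrix.unitaryGroup A ℂ := by
      rw [Matrix.mem_unitaryGroup_iff]
      have e1 : p * star p + q * star q = 1 := by
        simp [hp, hq, Complex.ext_iff]; norm_num
      have e2 : p * star q + q * star p = 0 := by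
        simp [hp, hq, Complex.ext_iff]; norm_num
      rw [star_add, star_smul, star_smul, pm_conj, star_one, hf, Equiv.symm_swap, ← hf]
      simp only [add_mul, mul_add, smul_mul_smul_comm, hpp, one_mul, mul_one]
      calc _ = (p * star p + q * star q) • (1 : Matrix A A ℂ)
            + (p * star q + q * star p) • pm f := by
            simp only [add_smul]; abel
        _ = 1 := by rw [e1, e2]; simp
    have h := hT _ hu
    have h2 := hT _ (pm_mem f)
    have hk : (p • (1 : Matrix A A ℂ) + q • pm f) ⊗ₖ (p • (1 : Matrix A A ℂ) + q • pm f)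
        = (p * p) • (1 : Matrix (A × A) (A × A) ℂ) + (p * q) •
          (pm (Equiv.prodCongr f (Equiv.refl A)) + pm (Equiv.prodCongr (Equiv.refl A) f))
          + (q * q) • (pm f ⊗ₖ pm f) := by
      rw [← pm_kron, ← pm_kron, pm_refl]
      simp only [add_kronecker, kronecker_add, smul_kronecker, kronecker_smul, one_kronecker_one,
        smul_smul, smul_add, mul_comm q p]
      abel
    rw [hk] at h
    simp only [add_mul, mul_add, smul_mul_assoc, mul_smul_comm, one_mul, mul_one, h2] at h
    have h3 := add_left_cancel (add_right_cancel h)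
    have hpq : p * q ≠ 0 := by
      simp [hp, hq, Complex.ext_iff]
    have h4 := smul_right_injective _ hpq h3
    have h5 := congrFun (congrFun h4 (a, a)) (a, b)
    simp only [Matrix.add_apply, pm_mul_apply, mul_pm_apply] at h5
    simp [hf] at h5
    have h6 : T (a, a) (b, b) = 0 := by
      by_contra h6
      rcases hzero _ _ _ _ h6 with h | h <;> exact hab h.1
    have h7 := hperm f a b b a
    simp [hf] at h7
    rw [h6, h7] at h5
    rw [← add_comm, h5]; simp
  obtain ⟨x, y, hxy⟩ := exists_pair_ne A
  have htrans : ∀ a b : A, a ≠ b → ∃ f : A ≃ A, f x = a ∧ f y = b := by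
    intro a b hab
    refine ⟨(Equiv.swap x a).trans (Equiv.swap (Equiv.swap x a y) b), ?_, ?_⟩
    · have : a ≠ Equiv.swap x a y := by
        intro h
        apply hxy
        apply (Equiv.swap x a).injective
        simpa using h
      simp [Equiv.swap_apply_of_ne_of_ne this hab]
    · simp
  have hoff : ∀ a b : A, a ≠ b → T (a, b) (a, b) = T (x, y) (x, y) ∧
      T (a, b) (b, a) = T (x, y) (y, x) := by
    intro a b hab
    obtain ⟨f, rfl, rfl⟩ := htrans a b hab
    exact ⟨hperm _ _ _ _ _, hperm _ _ _ _ _⟩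
  refine ⟨T (x, y) (x, y), T (x, y) (y, x), ?_⟩
  ext ⟨a, b⟩ ⟨c, d⟩
  simp only [Matrix.add_apply, Matrix.smul_apply, Matrix.one_apply, swapOp, Matrix.of_apply,
    smul_eq_mul, Prod.mk.injEq]
  by_cases hab : a = b
  · subst hab
    by_cases h : a = c ∧ a = d
    · obtain ⟨rfl, rfl⟩ := h
      obtain ⟨b, hb⟩ := exists_ne a
      rw [hsq a b hb.symm, (hoff a b hb.symm).1, (hoff a b hb.symm).2]
      simp
    · have h0 : T (a, a) (c, d) = 0 := by
        by_contra h0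
        rcases hzero _ _ _ _ h0 with h' | h'
        · exact h h'
        · exact h h'.symm
      rw [if_neg h, if_neg (fun h' => h h'.symm), h0]; simp
  · by_cases h1 : a = c ∧ b = d
    · obtain ⟨rfl, rfl⟩ := h1
      simp [hab, (hoff a b hab).1]
    · by_cases h2 : a = d ∧ b = c
      · obtain ⟨rfl, rfl⟩ := h2
        simp [hab, (hoff a b hab).2]
      · have h0 : T (a, b) (c, d) = 0 := by
          by_contra h0
          rcases hzero _ _ _ _ h0 with h' | h'
          · exact h1 h'
          · exact h2 h'
        rw [if_neg h1, if_neg h2, h0]; simp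

lemma swapOp_eq : swapOp A = pm (Equiv.prodComm A A) := by
  ext ⟨a, b⟩ ⟨c, d⟩
  simp [swapOp, pm, PEquiv.toMatrix_apply, and_comm, eq_comm]

lemma swapOp_comm (V : Matrix A A ℂ) : swapOp A * (V ⊗ₖ V) = (V ⊗ₖ V) * swapOp A := by
  ext ⟨a, b⟩ ⟨c, d⟩
  rw [swapOp_eq, pm_mul_apply, mul_pm_apply]
  simp [mul_comm]

lemma swapOp_trace_mul (M : Matrix (A × A) (A × A) ℂ) :
    (swapOp A * M).trace = ∑ a, ∑ b, M (b, a) (a, b) := by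
  simp only [swapOp_eq, Matrix.trace, Matrix.diag, pm_mul_apply, Fintype.sum_prod_type]
  rfl

/-- the integrand -/
def tw (X : Matrix (A × A) (A × A) ℂ) (U : Matrix.unitaryGroup A ℂ) :
    Matrix (A × A) (A × A) ℂ :=
  ((U : Matrix A A ℂ) ⊗ₖ (U : Matrix A A ℂ))ᴴ * X * ((U : Matrix A A ℂ) ⊗ₖ (U : Matrix A A ℂ))

lemma kk_unitary (V : Matrix A A ℂ) (hV : V ∈ Matrix.unitaryGroup A ℂ) :
    (V ⊗ₖ V) * (V ⊗ₖ V)ᴴ = 1 := by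
  rw [conjTranspose_kronecker, ← mul_kronecker_mul, ← star_eq_conjTranspose,
    Matrix.mem_unitaryGroup_iff.1 hV, one_kronecker_one]

lemma tw_cont_s6 (X : Matrix (A × A) (A × A) ℂ) : Continuous (tw X) := by
  have h : Continuous fun U : Matrix.unitaryGroup A ℂ =>
      (U : Matrix A A ℂ) ⊗ₖ (U : Matrix A A ℂ) := by
    refine continuous_matrix fun i j => ?_
    simp only [kroneckerMap_apply]
    have hc : Continuous fun U : Matrix.unitaryGroup A ℂ => (U : Matrix A A ℂ) :=
      continuous_subtype_val
    exact (hc.matrix_elem _ _).mul (hc.matrix_elem _ _)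
  exact (h.matrix_conjTranspose.matrix_mul continuous_const).matrix_mul h

lemma lin_int {E₀ E : Type} [NormedAddCommGroup E₀] [NormedSpace ℂ E₀] [FiniteDimensional ℂ E₀]
    [NormedAddCommGroup E] [NormedSpace ℂ E] [CompleteSpace E]
    (μ : Measure (Matrix.unitaryGroup A ℂ)) [IsProbabilityMeasure μ]
    (f : Matrix.unitaryGroup A ℂ → E₀) (hf : Continuous f) (L : E₀ →ₗ[ℂ] E) :
    L (∫ U, f U ∂μ) = ∫ U, L (f U) ∂μ := by
  have := twirl_compact (A := A)
  have := FiniteDimensional.complete ℂ E₀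
  have hi : Integrable f μ :=
    hf.integrable_of_hasCompactSupport (HasCompactSupport.of_compactSpace _)
  exact ((LinearMap.toContinuousLinearMap L).integral_comp_comm hi).symm

lemma tw_lin (X : Matrix (A × A) (A × A) ℂ) (μ : Measure (Matrix.unitaryGroup A ℂ))
    [IsProbabilityMeasure μ] {E : Type} [NormedAddCommGroup E] [NormedSpace ℂ E] [CompleteSpace E]
    (L : Matrix (A × A) (A × A) ℂ →ₗ[ℂ] E) :
    L (∫ U, tw X U ∂μ) = ∫ U, L (tw X U) ∂μ :=
  lin_int μ (tw X) (tw_cont_s6 X) L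

lemma tw_mul (X : Matrix (A × A) (A × A) ℂ) (U V : Matrix.unitaryGroup A ℂ) :
    tw X (U * V) = ((V : Matrix A A ℂ) ⊗ₖ (V : Matrix A A ℂ))ᴴ * tw X U *
      ((V : Matrix A A ℂ) ⊗ₖ (V : Matrix A A ℂ)) := by
  simp only [tw, Submonoid.coe_mul, mul_kronecker_mul, conjTranspose_mul, Matrix.mul_assoc]

lemma tw_comm_s6 (X : Matrix (A × A) (A × A) ℂ) (μ : Measure (Matrix.unitaryGroup A ℂ))
    [μ.IsHaarMeasure] [IsProbabilityMeasure μ] (V : Matrix A A ℂ)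
    (hV : V ∈ Matrix.unitaryGroup A ℂ) :
    (V ⊗ₖ V) * (∫ U, tw X U ∂μ) = (∫ U, tw X U ∂μ) * (V ⊗ₖ V) := by
  have := twirl_right_inv μ
  have h1 : (∫ U, tw X U ∂μ) = (V ⊗ₖ V)ᴴ * (∫ U, tw X U ∂μ) * (V ⊗ₖ V) := by
    have h2 := tw_lin X μ ((LinearMap.mulRight ℂ (V ⊗ₖ V)).comp
      (LinearMap.mulLeft ℂ ((V ⊗ₖ V)ᴴ)))
    simp only [LinearMap.comp_apply, LinearMap.mulRight_apply, LinearMap.mulLeft_apply] at h2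
    rw [h2, ← integral_mul_right_eq_self (tw X) ⟨V, hV⟩]
    simp only [tw_mul]
  conv_lhs => rw [h1]
  rw [← Matrix.mul_assoc, ← Matrix.mul_assoc, kk_unitary V hV, Matrix.one_mul]

lemma tw_trace (X M : Matrix (A × A) (A × A) ℂ) (μ : Measure (Matrix.unitaryGroup A ℂ))
    [IsProbabilityMeasure μ] (hM : ∀ V : Matrix A A ℂ, M * (V ⊗ₖ V) = (V ⊗ₖ V) * M) :
    (M * ∫ U, tw X U ∂μ).trace = (M * X).trace := by
  have h := tw_lin X μ ((Matrix.traceLinearMap (A × A) ℂ ℂ).comp (LinearMap.mulLeft ℂ M))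
  simp only [LinearMap.comp_apply, LinearMap.mulLeft_apply, Matrix.traceLinearMap_apply] at h
  rw [h]
  have : ∀ U : Matrix.unitaryGroup A ℂ, (M * tw X U).trace = (M * X).trace := by
    intro U
    rw [tw, ← Matrix.mul_assoc, Matrix.trace_mul_comm, ← Matrix.mul_assoc, ← Matrix.mul_assoc,
      ← hM, Matrix.mul_assoc M, kk_unitary _ U.2, Matrix.mul_one]
  simp [this]

end helpers

/-- **Twirl of the partial swap operator** `X = F_{A₂A₂'} ⊗ I_{A₁A₁'}` used in the
decoupling bound. -/
theorem twirl_partial_swap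
    (A₁ A₂ : Type) [Fintype A₁] [Fintype A₂] [DecidableEq A₁] [DecidableEq A₂]
    [Nonempty A₁] [Nonempty A₂]
    (hd : 2 ≤ Fintype.card A₁ * Fintype.card A₂)
    (X : Matrix ((A₁ × A₂) × (A₁ × A₂)) ((A₁ × A₂) × (A₁ × A₂)) ℂ)
    (hX : ∀ p q : (A₁ × A₂) × (A₁ × A₂),
      X p q = if p.1.1 = q.1.1 ∧ p.2.1 = q.2.1 ∧ p.1.2 = q.2.2 ∧ p.2.2 = q.1.2
        then 1 else 0)
    (μ : Measure (Matrix.unitaryGroup (A₁ × A₂) ℂ))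
    [μ.IsHaarMeasure] [IsProbabilityMeasure μ] :
    ∫ U : Matrix.unitaryGroup (A₁ × A₂) ℂ,
        ((U : Matrix (A₁ × A₂) (A₁ × A₂) ℂ) ⊗ₖ (U : Matrix (A₁ × A₂) (A₁ × A₂) ℂ))ᴴ * X *
          ((U : Matrix (A₁ × A₂) (A₁ × A₂) ℂ) ⊗ₖ (U : Matrix (A₁ × A₂) (A₁ × A₂) ℂ)) ∂μ
      = ((1 / (Fintype.card A₂ : ℂ)) *
            ((1 - 1 / (Fintype.card A₁ : ℂ) ^ 2) /
              (1 - 1 / ((Fintype.card A₁ : ℂ) * (Fintype.card A₂ : ℂ)) ^ 2)))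
            • (1 : Matrix ((A₁ × A₂) × (A₁ × A₂)) ((A₁ × A₂) × (A₁ × A₂)) ℂ)
        + ((1 / (Fintype.card A₁ : ℂ)) *
            ((1 - 1 / (Fintype.card A₂ : ℂ) ^ 2) /
              (1 - 1 / ((Fintype.card A₁ : ℂ) * (Fintype.card A₂ : ℂ)) ^ 2)))
            • swapOp (A₁ × A₂) := by
  change ∫ U, tw X U ∂μ = _
  have : Nontrivial (A₁ × A₂) := by
    rw [← Fintype.one_lt_card_iff_nontrivial, Fintype.card_prod]; omega
  obtain ⟨β, γ, hT⟩ := twirl_schur _ (tw_comm_s6 X μ)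
  have t1 := tw_trace X 1 μ (by simp)
  have t2 := tw_trace X (swapOp _) μ swapOp_comm
  rw [hT] at t1 t2 ⊢
  rw [Matrix.one_mul, Matrix.one_mul] at t1
  have c1 : X.trace = (Fintype.card A₁ : ℂ) ^ 2 * Fintype.card A₂ := by
    simp only [Matrix.trace, Matrix.diag, Fintype.sum_prod_type, hX]
    simp [ite_and, eq_comm]
    ring
  have c2 : (swapOp (A₁ × A₂) * X).trace = (Fintype.card A₁ : ℂ) * Fintype.card A₂ ^ 2 := by
    simp only [swapOp_trace_mul, Fintype.sum_prod_type, hX]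
    simp [ite_and, eq_comm]
    ring
  have c3 : (swapOp (A₁ × A₂)).trace = (Fintype.card A₁ : ℂ) * Fintype.card A₂ := by
    rw [← Matrix.mul_one (swapOp _), swapOp_trace_mul]
    simp [Matrix.one_apply, ite_and, eq_comm]
  have c4 : (swapOp (A₁ × A₂) * swapOp (A₁ × A₂)).trace
      = ((Fintype.card A₁ : ℂ) * Fintype.card A₂) ^ 2 := by
    rw [swapOp_trace_mul]
    simp [swapOp]
    ring
  rw [c1, Matrix.trace_add, Matrix.trace_smul, Matrix.trace_smul, c3, Matrix.trace_one] at t1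
  rw [c2, Matrix.mul_add, Matrix.mul_smul, Matrix.mul_smul, Matrix.mul_one, Matrix.trace_add,
    Matrix.trace_smul, Matrix.trace_smul, c3, c4] at t2
  simp only [Fintype.card_prod, Nat.cast_mul, smul_eq_mul] at t1 t2
  have n1 : (Fintype.card A₁ : ℂ) ≠ 0 := by simp
  have n2 : (Fintype.card A₂ : ℂ) ≠ 0 := by simp
  have n3 : ((Fintype.card A₁ : ℂ) * Fintype.card A₂) ^ 2 - 1 ≠ 0 := by
    rw [sub_ne_zero]
    have : (Fintype.card A₁ * Fintype.card A₂) ^ 2 ≠ 1 := by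
      intro h; nlinarith
    exact_mod_cast this
  generalize (Fintype.card A₁ : ℂ) = x at *
  generalize (Fintype.card A₂ : ℂ) = y at *
  have n4 : 1 - 1 / (x * y) ^ 2 = ((x * y) ^ 2 - 1) / (x * y) ^ 2 := by
    field_simp
  have hxy : x * y ≠ 0 := mul_ne_zero n1 n2
  have hβ : β = (x ^ 2 * y - y) / ((x * y) ^ 2 - 1) := by
    rw [eq_div_iff n3]
    apply mul_left_cancel₀ hxy
    linear_combination (x * y) * t1 - t2
  have hγ : γ = (x * y ^ 2 - x) / ((x * y) ^ 2 - 1) := by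
    rw [eq_div_iff n3]
    apply mul_left_cancel₀ hxy
    linear_combination (x * y) * t2 - t1
  rw [n4, hβ, hγ]
  congr 2
  · field_simp
  · field_simp
end
end
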